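/- Let W be a finite set of variables disjoint from the variables of α, let S be a finite set of atoms, each of the form u ≤ u' with u, u' ∈ W, or c_i ≤ u, or u ≤ c_i with u ∈ W and i ∈ {0,1,2,3}, and let S' be obtained from S by replacing each constant c_i by the variable w_i. Then the following are equivalent: (i) there exists g : W → {0,1,2,3} such that every atom of S holds in B when each constant c_i is interpreted as the element i; (ii) for every assignment f : {y_0,y_1,y_2,y_3} → B there exists an assignment of the variables {x_0,x_1,x_2,x_3,w_0,w_1,w_2,w_3} ∪ W extending f that satisfies every atom of α and every atom of S' in B. -/

import Mathlib

/-- The order of the bowtie poset `B` on `{0,1,2,3}`: reflexive pairs together with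
`0 < 1`, `0 < 3`, `2 < 1`, `2 < 3` (so `0,2` are incomparable and `1,3` are incomparable). -/
def Ble (a b : Fin 4) : Prop := a = b ∨ ((a = 0 ∨ a = 2) ∧ (b = 1 ∨ b = 3))

/-- The assignment `x_i ↦ x i`, `y_i ↦ y i`, `w_i ↦ w i` satisfies every atom of the
conjunction `α` in `B`. -/
def AlphaSat (x y w : Fin 4 → Fin 4) : Prop :=
  Ble (w 0) (w 1) ∧ Ble (w 0) (w 3) ∧ Ble (w 2) (w 1) ∧ Ble (w 2) (w 3) ∧
  Ble (x 0) (y 0) ∧ Ble (x 0) (w 0) ∧ Ble (x 2) (y 2) ∧ Ble (x 2) (w 2) ∧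
  Ble (y 1) (x 1) ∧ Ble (w 1) (x 1) ∧ Ble (y 3) (x 3) ∧ Ble (w 3) (x 3)

/-- The assignment `y_i ↦ f i` is nontrivial: `{f y_0, f y_2} = {0,2}` and
`{f y_1, f y_3} = {1,3}`. -/
def NontrivialAssign (f : Fin 4 → Fin 4) : Prop :=
  ({f 0, f 2} : Set (Fin 4)) = {0, 2} ∧ ({f 1, f 3} : Set (Fin 4)) = {1, 3}

/-- Evaluation of a term of an atom of `S'` (constants `c_i` replaced by variables `w_i`):
a variable `u ∈ W` is evaluated by `h`, and the variable `w_i` is evaluated by `w`. -/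
def evalW {W : Type*} (h : W → Fin 4) (w : Fin 4 → Fin 4) : W ⊕ Fin 4 → Fin 4
  | Sum.inl u => h u
  | Sum.inr i => w i

/-- Evaluation of a term of an atom of `S`: a variable `u ∈ W` is evaluated by `g`, and
the constant `c_i` is interpreted as the element `i` of `B`. -/
def evalC {W : Type*} (g : W → Fin 4) : W ⊕ Fin 4 → Fin 4
  | Sum.inl u => g u
  | Sum.inr i => i

instance (a b : Fin 4) : Decidable (Ble a b) := by
  unfold Ble; infer_instance

theorem Ble.refl (a : Fin 4) : Ble a a := Or.inl rfl

/-- Two elements either have a common lower bound which is a minimal element of `B`, hence shares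
an upper bound with every element, or they are the two minimal elements of `B`. -/
theorem exists_common_lower_or (a b : Fin 4) :
    (∃ c, Ble c a ∧ Ble c b ∧ ∀ z, ∃ d, Ble z d ∧ Ble c d) ∨
      (a = 0 ∧ b = 2) ∨ (a = 2 ∧ b = 0) := by
  revert a b; decide

/-- Two elements either have a common upper bound which is a maximal element of `B`, hence shares
a lower bound with every element, or they are the two maximal elements of `B`. -/
theorem exists_common_upper_or (a b : Fin 4) :
    (∃ c, Ble a c ∧ Ble b c ∧ ∀ z, ∃ d, Ble d z ∧ Ble d c) ∨
      (a = 1 ∧ b = 3) ∨ (a = 3 ∧ b = 1) := by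
  revert a b; decide

/-- Every map satisfying the atoms of `α` among the variables `w_i` is an endomorphism of `B`. -/
theorem AlphaSat.map_ble {x y w : Fin 4 → Fin 4} (h : AlphaSat x y w) {a b : Fin 4}
    (hab : Ble a b) : Ble (w a) (w b) := by
  obtain ⟨h01, h03, h21, h23, -⟩ := h
  rcases hab with rfl | ⟨rfl | rfl, rfl | rfl⟩
  exacts [Ble.refl _, h01, h03, h21, h23]

/-- The conjunction `α` is satisfiable for every assignment of the variables `y_i`. -/
theorem exists_alphaSat (f : Fin 4 → Fin 4) : ∃ x w : Fin 4 → Fin 4, AlphaSat x f w := by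
  rcases exists_common_lower_or (f 0) (f 2) with ⟨c, h0, h2, hc⟩ | hlow
  · obtain ⟨d, hd, hcd⟩ := hc (f 1)
    obtain ⟨e, he, hce⟩ := hc (f 3)
    exact ⟨![c, d, c, e], fun _ => c, Ble.refl _, Ble.refl _, Ble.refl _, Ble.refl _,
      h0, Ble.refl _, h2, Ble.refl _, hd, hcd, he, hce⟩
  rcases exists_common_upper_or (f 1) (f 3) with ⟨c, h1, h3, hc⟩ | hupp
  · obtain ⟨d, hd, hcd⟩ := hc (f 0)
    obtain ⟨e, he, hce⟩ := hc (f 2)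
    exact ⟨![d, c, e, c], fun _ => c, Ble.refl _, Ble.refl _, Ble.refl _, Ble.refl _,
      hd, hcd, he, hce, h1, Ble.refl _, h3, Ble.refl _⟩
  · refine ⟨f, f, ?_⟩
    rcases hlow with ⟨h0, h2⟩ | ⟨h0, h2⟩ <;> rcases hupp with ⟨h1, h3⟩ | ⟨h1, h3⟩ <;>
      simp [AlphaSat, Ble, h0, h1, h2, h3]

/-- When each `y_i` is assigned `i`, the conjunction `α` forces each `w_i` to be `i`. -/
theorem AlphaSat.eq_id {x w : Fin 4 → Fin 4} (h : AlphaSat x id w) : w = id := by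
  obtain ⟨h01, h03, h21, h23, hx0, hw0, hx2, hw2, hx1, hw1, hx3, hw3⟩ := h
  have low : ∀ p q : Fin 4, (Ble p 0 → Ble p q → q ≠ 2) ∧ (Ble p 2 → Ble p q → q ≠ 0) := by
    decide
  have upp : ∀ p q : Fin 4, (Ble 1 p → Ble q p → q ≠ 3) ∧ (Ble 3 p → Ble q p → q ≠ 1) := by
    decide
  have key : ∀ a b c d : Fin 4, a ≠ 2 → c ≠ 0 → b ≠ 3 → d ≠ 1 →
      Ble a b → Ble a d → Ble c b → Ble c d → a = 0 ∧ b = 1 ∧ c = 2 ∧ d = 3 := by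
    decide
  obtain ⟨e0, e1, e2, e3⟩ := key _ _ _ _ ((low _ _).1 hx0 hw0) ((low _ _).2 hx2 hw2)
    ((upp _ _).1 hx1 hw1) ((upp _ _).2 hx3 hw3) h01 h03 h21 h23
  funext i
  fin_cases i <;> assumption

theorem evalW_comp {W : Type*} (g : W → Fin 4) (w : Fin 4 → Fin 4) (t : W ⊕ Fin 4) :
    evalW (w ∘ g) w t = w (evalC g t) := by
  cases t <;> rfl

theorem evalW_id {W : Type*} (g : W → Fin 4) (t : W ⊕ Fin 4) : evalW g id t = evalC g t := by
  cases t <;> rfl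

/-- Let `W` be a finite set of variables disjoint from the variables of `α`,
`S` a finite set of atoms, each of the form `u ≤ u'` with `u, u' ∈ W`, or `c_i ≤ u`, or
`u ≤ c_i` with `u ∈ W`, and `S'` the result of replacing each constant `c_i` by the
variable `w_i`.  The following are equivalent: (i) some `g : W → B` satisfies every atom
of `S` in `B` with each `c_i` interpreted as `i` (truth of `ψ` in `B*`); (ii) for every
assignment `f` of `{y_0,…,y_3}` there is an assignment of `{x_0,…,x_3,w_0,…,w_3} ∪ W`
extending `f` satisfying every atom of `α` and of `S'` in `B` (truth of `φ` in `B`). -/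
theorem stmt_12 {W : Type*} [Fintype W]
    (S : Set ((W ⊕ Fin 4) × (W ⊕ Fin 4)))
    (hS : ∀ a ∈ S, (∃ u : W, a.1 = Sum.inl u) ∨ (∃ u : W, a.2 = Sum.inl u)) :
    (∃ g : W → Fin 4, ∀ a ∈ S, Ble (evalC g a.1) (evalC g a.2)) ↔
    (∀ f : Fin 4 → Fin 4, ∃ (x w : Fin 4 → Fin 4) (h : W → Fin 4),
      AlphaSat x f w ∧ ∀ a ∈ S, Ble (evalW h w a.1) (evalW h w a.2)) := by
  constructor
  · rintro ⟨g, hg⟩ f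
    obtain ⟨x, w, h⟩ := exists_alphaSat f
    refine ⟨x, w, w ∘ g, h, fun a ha => ?_⟩
    rw [evalW_comp, evalW_comp]
    exact h.map_ble (hg a ha)
  · intro H
    obtain ⟨x, w, g, h, hg⟩ := H id
    obtain rfl := h.eq_id
    exact ⟨g, fun a ha => by simpa only [evalW_id] using hg a ha⟩
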